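/- arXiv:math/0412415 — 2 statements merged into one kernel-verified Lean document; each statement's English description precedes it below -/
import Mathlib

section
/- Let N ≥ 1. In the complex group algebra ℂ[F_N], the square of the generating operator satisfies X_1 · X_1 = X_2 + 2N·1, where 1 is the identity of the algebra. -/
/-- `X N n` is the sum, in the complex group algebra `ℂ[F_N]`, of all group elements
whose reduced word has length `n`. -/
noncomputable def X (N : ℕ) (n : ℕ) : MonoidAlgebra ℂ (FreeGroup (Fin N)) :=
  ∑ᶠ g ∈ {g : FreeGroup (Fin N) | g.norm = n}, MonoidAlgebra.of ℂ (FreeGroup (Fin N)) g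

namespace FreeGroup

variable {α : Type*}

theorem mk_pair_eq_one {a b : α × Bool} (h : ¬(a.1 = b.1 → a.2 = b.2)) :
    mk [a, b] = 1 := by
  obtain ⟨x, s⟩ := a
  obtain ⟨y, t⟩ := b
  obtain ⟨rfl, hst⟩ := Classical.not_imp.mp h
  obtain rfl : t = !s := by cases s <;> cases t <;> simp_all
  exact Quot.sound Red.Step.cons_not

variable [DecidableEq α]

theorem bijOn_mk_singleton_norm_eq_one :
    Set.BijOn (fun a : α × Bool => mk [a]) Set.univ {g : FreeGroup α | g.norm = 1} := by
  have hw (a : α × Bool) : (mk [a]).toWord = [a] := by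
    rw [toWord_mk, IsReduced.reduce_eq (by simp [IsReduced])]
  refine ⟨fun a _ => by simp [norm, hw a, -toWord_mk], fun a _ b _ h => ?_, fun g hg => ?_⟩
  · simpa [hw, -toWord_mk] using congrArg toWord h
  · obtain ⟨a, ha⟩ := List.length_eq_one_iff.mp hg
    exact ⟨a, trivial, by simp only [← ha, mk_toWord]⟩

theorem bijOn_mk_pair_norm_eq_two :
    Set.BijOn (fun p : (α × Bool) × (α × Bool) => mk [p.1, p.2])
      {p | p.1.1 = p.2.1 → p.1.2 = p.2.2} {g : FreeGroup α | g.norm = 2} := by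
  have hw (p : (α × Bool) × (α × Bool)) (hp : p.1.1 = p.2.1 → p.1.2 = p.2.2) :
      (mk [p.1, p.2]).toWord = [p.1, p.2] := by
    rw [toWord_mk, IsReduced.reduce_eq (by simpa [IsReduced] using hp)]
  refine ⟨fun p hp => by simp [norm, hw p hp, -toWord_mk], fun p hp q hq h => ?_, fun g hg => ?_⟩
  · have := congrArg toWord h
    simp only [hw p hp, hw q hq] at this
    simpa [Prod.ext_iff] using this
  · obtain ⟨a, b, hab⟩ := List.length_eq_two.mp hg
    refine ⟨(a, b), ?_, by simp only [← hab, mk_toWord]⟩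
    have := isReduced_toWord (x := g)
    rw [hab] at this
    simpa [IsReduced] using this

end FreeGroup

theorem X_one_eq_sum (N : ℕ) :
    X N 1 = ∑ a : Fin N × Bool,
      MonoidAlgebra.of ℂ (FreeGroup (Fin N)) (FreeGroup.mk [a]) := by
  rw [X, ← finsum_mem_eq_of_bijOn _ FreeGroup.bijOn_mk_singleton_norm_eq_one fun _ _ => rfl,
    finsum_mem_univ, finsum_eq_sum_of_fintype]

theorem X_two_eq_sum (N : ℕ) :
    X N 2 = ∑ p : (Fin N × Bool) × (Fin N × Bool) with (p.1.1 = p.2.1 → p.1.2 = p.2.2),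
      MonoidAlgebra.of ℂ (FreeGroup (Fin N)) (FreeGroup.mk [p.1, p.2]) := by
  rw [X, ← finsum_mem_eq_of_bijOn _ FreeGroup.bijOn_mk_pair_norm_eq_two fun _ _ => rfl,
    ← finsum_mem_coe_finset]
  simp

theorem card_cancelling_pairs (N : ℕ) :
    Finset.card {p : (Fin N × Bool) × (Fin N × Bool) | ¬(p.1.1 = p.2.1 → p.1.2 = p.2.2)}
      = 2 * N := by
  have h : ({p : (Fin N × Bool) × (Fin N × Bool) | ¬(p.1.1 = p.2.1 → p.1.2 = p.2.2)} : Finset _)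
      = Finset.univ.image fun a : Fin N × Bool => (a, (a.1, !a.2)) := by
    ext ⟨⟨x, s⟩, ⟨y, t⟩⟩
    cases s <;> cases t <;> simp
  rw [h, Finset.card_image_of_injective _ fun a b hab => congrArg Prod.fst hab]
  simp [mul_comm]

/-- In `ℂ[F_N]`, the square of the generating operator satisfies
`X₁ · X₁ = X₂ + 2N·1`. -/
theorem stmt0 (N : ℕ) (hN : 1 ≤ N) :
    X N 1 * X N 1 = X N 2 + (2 * N : ℂ) • (1 : MonoidAlgebra ℂ (FreeGroup (Fin N))) := by
  rw [X_one_eq_sum, X_two_eq_sum, Finset.sum_mul_sum, ← Finset.sum_product',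
    Finset.univ_product_univ, ← Finset.sum_filter_add_sum_filter_not Finset.univ
      (fun p : (Fin N × Bool) × (Fin N × Bool) => p.1.1 = p.2.1 → p.1.2 = p.2.2)]
  simp_rw [← map_mul, FreeGroup.mul_mk, List.singleton_append]
  congr 1
  rw [Finset.sum_congr rfl fun p hp => by
      rw [FreeGroup.mk_pair_eq_one (Finset.mem_filter.mp hp).2, map_one],
    Finset.sum_const, card_cancelling_pairs, ← Nat.cast_smul_eq_nsmul ℂ]
  push_cast
  rfl
end

section
/- Let N ≥ 1 and n ≥ 2. In the complex group algebra ℂ[F_N], one has X_1 · X_n = X_{n+1} + (2N−1)·X_{n−1}. -/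
namespace FreeGroup

variable {α : Type*} [DecidableEq α]

theorem finite_setOf_norm_eq [Finite α] (n : ℕ) : {g : FreeGroup α | g.norm = n}.Finite :=
  (List.finite_length_eq (α × Bool) n).preimage toWord_injective.injOn

theorem mk_singleton_injective : Function.Injective fun s : α × Bool => mk [s] := by
  intro s t h
  simpa [reduce_singleton] using congrArg toWord h

theorem setOf_norm_eq_one :
    {g : FreeGroup α | g.norm = 1} = Set.range fun s : α × Bool => mk [s] := by
  ext g
  constructor
  · intro h
    obtain ⟨s, hs⟩ := List.length_eq_one_iff.1 h
    exact ⟨s, by simp only [← hs, mk_toWord]⟩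
  · rintro ⟨s, rfl⟩
    simp [norm]

theorem norm_mk_singleton_inv_mul (s : α × Bool) {g : FreeGroup α} {h : α × Bool}
    {t : List (α × Bool)} (hg : g.toWord = h :: t) :
    ((mk [s])⁻¹ * g).norm = if s = h then t.length else t.length + 2 := by
  have hred : reduce (h :: t) = h :: t := by rw [← hg, reduce_toWord]
  have hmul : (mk [s])⁻¹ * g = mk ((s.1, !s.2) :: h :: t) := by
    conv_lhs => rw [← mk_toWord (x := g), hg]
    simp [inv_mk, mul_mk, invRev]
  rw [hmul, norm, toWord_mk, reduce.cons, hred]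
  obtain ⟨a, b⟩ := s
  obtain ⟨c, d⟩ := h
  by_cases hs : a = c ∧ b = d <;> simp [hs]

end FreeGroup

open FreeGroup

theorem coeff_X (N n : ℕ) (g : FreeGroup (Fin N)) :
    (X N n).coeff g = if g.norm = n then 1 else 0 := by
  classical
  rw [X, finsum_mem_eq_finite_toFinset_sum _ (finite_setOf_norm_eq n)]
  simp [MonoidAlgebra.coeff_sum, Finsupp.single_apply]

theorem X_one (N : ℕ) :
    X N 1 = ∑ s : Fin N × Bool, MonoidAlgebra.single (FreeGroup.mk [s]) 1 := by
  rw [X, setOf_norm_eq_one, finsum_mem_range mk_singleton_injective, finsum_eq_sum_of_fintype]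
  rfl

theorem coeff_X_one_mul (N : ℕ) (x : MonoidAlgebra ℂ (FreeGroup (Fin N)))
    (g : FreeGroup (Fin N)) :
    (X N 1 * x).coeff g = ∑ s : Fin N × Bool, x.coeff ((FreeGroup.mk [s])⁻¹ * g) := by
  simp [X_one, Finset.sum_mul, MonoidAlgebra.coeff_sum, -inv_mk]

/-- In `ℂ[F_N]`, for `n ≥ 2`, one has `X₁ · Xₙ = X_{n+1} + (2N−1)·X_{n−1}`. -/
theorem stmt1 (N : ℕ) (hN : 1 ≤ N) (n : ℕ) (hn : 2 ≤ n) :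
    X N 1 * X N n = X N (n + 1) + (2 * (N : ℂ) - 1) • X N (n - 1) := by
  ext g
  rw [coeff_X_one_mul]
  simp only [MonoidAlgebra.coeff_add, MonoidAlgebra.coeff_smul, Finsupp.add_apply,
    Finsupp.smul_apply, coeff_X, smul_eq_mul]
  rcases hg : g.toWord with _ | ⟨h, t⟩
  · obtain rfl := toWord_eq_nil_iff.1 hg
    have hs (s : Fin N × Bool) : ((FreeGroup.mk [s])⁻¹ * 1).norm = 1 := by
      rw [mul_one, norm_inv_eq, FreeGroup.norm, toWord_mk, reduce_singleton, List.length_singleton]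
    have h0 : (1 : ℕ) ≠ n := by omega
    have h1 : (0 : ℕ) ≠ n - 1 := by omega
    simp only [hs, h0, h1, FreeGroup.norm_one]
    simp
  · have hnorm : g.norm = t.length + 1 := by rw [FreeGroup.norm, hg, List.length_cons]
    simp only [norm_mk_singleton_inv_mul _ hg, hnorm]
    rw [← Finset.add_sum_erase _ _ (Finset.mem_univ h), if_pos rfl,
      Finset.sum_congr rfl fun s hs => by rw [if_neg (Finset.ne_of_mem_erase hs)],
      Finset.sum_const, Finset.card_erase_of_mem (Finset.mem_univ h), Finset.card_univ,
      Fintype.card_prod, Fintype.card_fin, Fintype.card_bool, nsmul_eq_mul,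
      Nat.cast_sub (by omega)]
    have h1 : t.length + 1 = n + 1 ↔ t.length = n := by omega
    have h2 : t.length + 1 = n - 1 ↔ t.length + 2 = n := by omega
    simp only [h1, h2]
    push_cast
    ring
end
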